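/- arXiv:2503.14809 — 2 statements merged into one kernel-verified Lean document; each statement's English description precedes it below -/
import Mathlib

section
/- Let γ ∈ ℝ with |γ| < 1, let Φ : X → ℝ be bounded (there exists C ≥ 0 with |Φ y| ≤ C for all y ∈ X), and let x : ℕ → X be any trajectory. Then the sequence t ↦ γ^t · (γ · Φ(x (t+1)) − Φ(x t)) is summable, and its infinite sum equals −Φ(x 0): ∑'_{t} γ^t · (γ · Φ(x (t+1)) − Φ(x t)) = −Φ(x 0). -/
/-- For `|γ| < 1` and a bounded potential, the discounted shaping terms are
summable and sum to `-Φ (x 0)`. -/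
theorem shaping_terms_summable_tsum {X : Type*} (γ : ℝ) (hγ : |γ| < 1)
    (Φ : X → ℝ) (C : ℝ) (hC : 0 ≤ C) (hΦ : ∀ y, |Φ y| ≤ C) (x : ℕ → X) :
    Summable (fun t : ℕ => γ ^ t * (γ * Φ (x (t + 1)) - Φ (x t))) ∧
      ∑' t : ℕ, γ ^ t * (γ * Φ (x (t + 1)) - Φ (x t)) = -Φ (x 0) := by
  have hs : Summable (fun t : ℕ => γ ^ t * Φ (x t)) := by
    refine Summable.of_norm_bounded (g := fun t : ℕ => |γ| ^ t * C)
      ((summable_geometric_of_lt_one (abs_nonneg γ) hγ).mul_right C) ?_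
    intro t
    rw [Real.norm_eq_abs, abs_mul, abs_pow]
    exact mul_le_mul_of_nonneg_left (hΦ _) (by positivity)
  have hs1 : Summable (fun t : ℕ => γ ^ (t + 1) * Φ (x (t + 1))) :=
    (summable_nat_add_iff (f := fun t : ℕ => γ ^ t * Φ (x t)) 1).2 hs
  have he : (fun t : ℕ => γ ^ t * (γ * Φ (x (t + 1)) - Φ (x t))) =
      fun t : ℕ => γ ^ (t + 1) * Φ (x (t + 1)) - γ ^ t * Φ (x t) := by
    funext t
    ring
  rw [he]
  refine ⟨hs1.sub hs, ?_⟩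
  rw [hs1.tsum_sub hs, hs.tsum_eq_zero_add]
  simp
end

section
/- Let γ ∈ ℝ with 0 ≤ γ < 1, let Φ : X → ℝ be bounded (there exists C ≥ 0 with |Φ y| ≤ C for all y), let x : ℕ → X be a trajectory, and let r : ℕ → ℝ be a bounded reward sequence (there exists B ≥ 0 with |r t| ≤ B for all t). Then both the unshaped series t ↦ γ^t · r t and the shaped series t ↦ γ^t · (r t + γ · Φ(x (t+1)) − Φ(x t)) are summable, and the shaped infinite-horizon return equals the unshaped return shifted by a constant depending only on the initial state: ∑'_{t} γ^t · (r t + γ · Φ(x (t+1)) − Φ(x t)) = (∑'_{t} γ^t · r t) − Φ(x 0). -/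
/-- For `0 ≤ γ < 1`, bounded potential and bounded rewards, both the unshaped
and shaped series are summable and the shaped infinite-horizon return equals
the unshaped return minus the initial potential. -/
theorem shaped_tsum_eq_tsum_sub_initial_potential {X : Type*} (γ : ℝ)
    (hγ0 : 0 ≤ γ) (hγ1 : γ < 1)
    (Φ : X → ℝ) (C : ℝ) (hC : 0 ≤ C) (hΦ : ∀ y, |Φ y| ≤ C)
    (x : ℕ → X) (r : ℕ → ℝ) (B : ℝ) (hB : 0 ≤ B) (hr : ∀ t, |r t| ≤ B) :
    Summable (fun t : ℕ => γ ^ t * r t) ∧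
    Summable (fun t : ℕ => γ ^ t * (r t + γ * Φ (x (t + 1)) - Φ (x t))) ∧
      ∑' t : ℕ, γ ^ t * (r t + γ * Φ (x (t + 1)) - Φ (x t)) =
        (∑' t : ℕ, γ ^ t * r t) - Φ (x 0) := by
  have key : ∀ (f : ℕ → ℝ) (K : ℝ), (∀ t, |f t| ≤ K) →
      Summable (fun t : ℕ => γ ^ t * f t) := by
    intro f K hf
    refine Summable.of_norm_bounded
      ((summable_geometric_of_lt_one hγ0 hγ1).mul_right K) ?_
    intro t
    rw [Real.norm_eq_abs, abs_mul, abs_of_nonneg (pow_nonneg hγ0 t)]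
    exact mul_le_mul_of_nonneg_left (hf t) (pow_nonneg hγ0 t)
  have h1 := key r B hr
  have h2 := key (fun t => Φ (x t)) C (fun t => hΦ _)
  have h3 := (summable_nat_add_iff 1).2 h2
  have h4 := h2.tsum_eq_zero_add
  have e : (fun t : ℕ => γ ^ t * (r t + γ * Φ (x (t + 1)) - Φ (x t))) =
      fun t => (γ ^ t * r t + γ ^ (t + 1) * Φ (x (t + 1))) - γ ^ t * Φ (x t) := by
    funext t
    ring
  rw [e]
  refine ⟨h1, (h1.add h3).sub h2, ?_⟩
  rw [(h1.add h3).tsum_sub h2, h1.tsum_add h3, h4]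
  simp
end
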